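/- arXiv:1508.01064 — 8 statements merged into one kernel-verified Lean document; each statement's English description precedes it below -/
import Mathlib

section
/- Suppose g, f, f' ∈ M satisfy T₁g − g = T₃f − f and T₂g − g = T₃f' − f'. Then the element T₂f − f − T₁f' + f' is T₃-invariant, i.e. T₃(T₂f − f − T₁f' + f') = T₂f − f − T₁f' + f'. -/
/-- If `T₁g − g = T₃f − f` and `T₂g − g = T₃f' − f'` for pairwise
commuting additive endomorphisms `T₁, T₂, T₃` of an abelian group `M`, then
`T₂f − f − T₁f' + f'` is `T₃`-invariant. -/
theorem stmt_4 {M : Type*} [AddCommGroup M] (T₁ T₂ T₃ : M →+ M)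
    (h12 : ∀ m, T₁ (T₂ m) = T₂ (T₁ m)) (h13 : ∀ m, T₁ (T₃ m) = T₃ (T₁ m))
    (h23 : ∀ m, T₂ (T₃ m) = T₃ (T₂ m))
    (g f f' : M)
    (h1 : T₁ g - g = T₃ f - f) (h2 : T₂ g - g = T₃ f' - f') :
    T₃ (T₂ f - f - T₁ f' + f') = T₂ f - f - T₁ f' + f' := by
  have hT₂ := congrArg T₂ h1
  have hT₁ := congrArg T₁ h2
  simp only [map_sub, h12, h13, h23] at hT₁ hT₂
  simp only [map_add, map_sub]
  grind
end

section
/- Assume that T₃ acts minimally, i.e. every orbit {T₃ⁿ(x) : n ∈ ℤ} is dense in Σ. If f ∈ C(Σ, ℤ) satisfies f ∘ T₃ = f and f belongs to the subgroup of C(Σ, ℤ) generated by the set {g − g∘T₁ : g ∈ C(Σ, ℤ)} ∪ {g − g∘T₂ : g ∈ C(Σ, ℤ)}, then f = 0. (This expresses the injectivity of the natural map from the ⟨T₁, T₂⟩-coinvariants of C(Σ, ℤ)^{⟨T₃⟩} to the ⟨T₁, T₂⟩-coinvariants of C(Σ, ℤ) when ⟨T₃⟩ acts minimally.) -/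
open MeasureTheory

/-- Integer-valued coboundaries of continuous functions have zero integral with respect to a
finite measure that is invariant under the map. -/
theorem integral_intCast_coboundary_eq_zero {X : Type*} [TopologicalSpace X] [CompactSpace X]
    [MeasurableSpace X] [BorelSpace X] {μ : Measure X} [IsFiniteMeasure μ] {T : X → X}
    (hT : Continuous T) (hμ : ∀ g : X → ℝ, Continuous g → ∫ x, g (T x) ∂μ = ∫ x, g x ∂μ)
    {g : X → ℤ} (hg : Continuous g) : ∫ x, ((g x - g (T x) : ℤ) : ℝ) ∂μ = 0 := by
  have hg' : Continuous fun x => (g x : ℝ) := continuous_of_discreteTopology.comp hg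
  have hint : ∀ u : X → ℝ, Continuous u → Integrable u μ := fun u hu =>
    hu.integrable_of_hasCompactSupport (HasCompactSupport.of_compactSpace u)
  simp only [Int.cast_sub]
  rw [integral_sub (hint _ hg') (hint (fun x => (g (T x) : ℝ)) (hg'.comp hT)), hμ _ hg', sub_self]

/-- A continuous integer-valued function that is invariant under a map with a dense orbit is
constant along the closure of that orbit. -/
theorem eq_of_dense_orbit_of_comp_eq {X : Type*} [TopologicalSpace X] {T : Equiv.Perm X} {x : X}
    (hx : Dense (Set.range fun n : ℤ => (T ^ n) x)) {f : X → ℤ} (hf : Continuous f)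
    (hfT : ∀ y, f (T y) = f y) (y : X) : f y = f x := by
  have hinv : ∀ n : ℤ, ∀ z, f ((T ^ n) z) = f z := by
    intro n
    induction n with
    | zero => simp
    | succ n ih => intro z; rw [zpow_add_one, Equiv.Perm.mul_apply, ih, hfT]
    | pred n ih =>
      intro z
      rw [zpow_sub_one, Equiv.Perm.mul_apply, ih, ← hfT, ← Equiv.Perm.mul_apply, mul_inv_cancel,
        Equiv.Perm.one_apply]
  refine congrFun (hf.ext_on hx continuous_const ?_) y
  rintro _ ⟨n, rfl⟩
  exact hinv n x

/-- Let `X` be a nonempty compact Hausdorff space with three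
pairwise commuting homeomorphisms `T₁, T₂, T₃` and a Borel probability
measure `μ` invariant under `T₁` and `T₂`. Assume `T₃` acts minimally. If a
continuous `f : X → ℤ` satisfies `f ∘ T₃ = f` and lies in the subgroup of
`C(X, ℤ)` generated by `{g − g∘T₁} ∪ {g − g∘T₂}`, then `f = 0`. -/
theorem stmt_6 {X : Type*} [TopologicalSpace X] [CompactSpace X] [T2Space X] [Nonempty X]
    [MeasurableSpace X] [BorelSpace X]
    (T₁ T₂ T₃ : X ≃ₜ X)
    (h12 : ∀ x, T₁ (T₂ x) = T₂ (T₁ x)) (h13 : ∀ x, T₁ (T₃ x) = T₃ (T₁ x))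
    (h23 : ∀ x, T₂ (T₃ x) = T₃ (T₂ x))
    (μ : Measure X) [IsProbabilityMeasure μ]
    (hμ1 : ∀ g : X → ℝ, Continuous g → ∫ x, g (T₁ x) ∂μ = ∫ x, g x ∂μ)
    (hμ2 : ∀ g : X → ℝ, Continuous g → ∫ x, g (T₂ x) ∂μ = ∫ x, g x ∂μ)
    (hmin : ∀ x : X, Dense (Set.range fun n : ℤ => (T₃.toEquiv ^ n) x))
    (f : X → ℤ) (hf : Continuous f) (hfT3 : ∀ x, f (T₃ x) = f x)
    (hfsub : f ∈ AddSubgroup.closure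
      ({h | ∃ g : X → ℤ, Continuous g ∧ h = g - fun x => g (T₁ x)} ∪
       {h | ∃ g : X → ℤ, Continuous g ∧ h = g - fun x => g (T₂ x)})) :
    f = 0 := by
  have hconst := eq_of_dense_orbit_of_comp_eq (hmin (Classical.arbitrary X)) hf hfT3
  have hint : ∀ u : X → ℤ, Continuous u → Integrable (fun x => (u x : ℝ)) μ := fun u hu =>
    (continuous_of_discreteTopology.comp hu).integrable_of_hasCompactSupport
      (HasCompactSupport.of_compactSpace _)
  have key : Continuous f ∧ ∫ x, (f x : ℝ) ∂μ = 0 := by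
    refine AddSubgroup.closure_induction
      (p := fun (u : X → ℤ) _ => Continuous u ∧ ∫ x, (u x : ℝ) ∂μ = 0) ?_ ?_ ?_ ?_ hfsub
    · rintro _ (⟨g, hg, rfl⟩ | ⟨g, hg, rfl⟩)
      · exact ⟨hg.sub (hg.comp T₁.continuous),
          integral_intCast_coboundary_eq_zero T₁.continuous hμ1 hg⟩
      · exact ⟨hg.sub (hg.comp T₂.continuous),
          integral_intCast_coboundary_eq_zero T₂.continuous hμ2 hg⟩
    · exact ⟨continuous_const, by simp⟩
    · rintro u v - - ⟨hu, hu0⟩ ⟨hv, hv0⟩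
      refine ⟨hu.add hv, ?_⟩
      simp only [Pi.add_apply, Int.cast_add]
      rw [integral_add (hint u hu) (hint v hv), hu0, hv0, add_zero]
    · rintro u - ⟨hu, hu0⟩
      refine ⟨hu.neg, ?_⟩
      simp only [Pi.neg_apply, Int.cast_neg]
      rw [integral_neg, hu0, neg_zero]
  have hzero := key.2
  simp only [hconst, integral_const, probReal_univ, one_smul, Int.cast_eq_zero] at hzero
  funext y
  rw [hconst y, hzero, Pi.zero_apply]
end

section
/- Suppose Λ satisfies Hypothesis (H) with data K₁, …, K_q, r, j₁, j₂, j₃, β. Then the index maps j₁, j₂ : {1,…,q} → {1,…,r} and j₃ : {r+1,…,q} → {1,…,r} are uniquely determined by the K_i, the restrictions of j₁ and j₂ to {1,…,r} are permutations of {1,…,r}, and j₁(j₂(i)) = j₂(j₁(i)) for every i ∈ {1,…,q}. -/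
/-- Two sets are translates of each other under an integer power of the permutation `S`. -/
def IsZPowTranslate {X : Type*} (S : Equiv.Perm X) (A B : Set X) : Prop :=
  ∃ m : ℤ, A = (S ^ m) '' B

namespace IsZPowTranslate

variable {X : Type*} {S : Equiv.Perm X} {A B C : Set X}

theorem symm (h : IsZPowTranslate S A B) : IsZPowTranslate S B A := by
  obtain ⟨m, rfl⟩ := h
  refine ⟨-m, ?_⟩
  rw [← Set.image_comp, ← Equiv.Perm.coe_mul, ← zpow_add]
  simp

theorem trans (h : IsZPowTranslate S A B) (h' : IsZPowTranslate S B C) :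
    IsZPowTranslate S A C := by
  obtain ⟨m, rfl⟩ := h
  obtain ⟨n, rfl⟩ := h'
  exact ⟨m + n, by rw [← Set.image_comp, ← Equiv.Perm.coe_mul, ← zpow_add]⟩

theorem image {T : Equiv.Perm X} (hT : Commute T S) (h : IsZPowTranslate S A B) :
    IsZPowTranslate S (T '' A) (T '' B) := by
  obtain ⟨m, rfl⟩ := h
  exact ⟨m, by simp only [← Set.image_comp, ← Equiv.Perm.coe_mul, (hT.zpow_right m).eq]⟩

theorem of_image {T : Equiv.Perm X} (hT : Commute T S)
    (h : IsZPowTranslate S (T '' A) (T '' B)) : IsZPowTranslate S A B := by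
  simpa [← Set.image_comp, ← Equiv.Perm.coe_mul] using h.image hT.inv_left

theorem eq_of_disjoint_saturations {ι : Type*} {K : ι → Set X} {p : ι → Prop}
    (hne : ∀ i, (K i).Nonempty)
    (hsat : ∀ i j, p i → p j → i ≠ j →
      Disjoint (⋃ n : ℤ, (S ^ n) '' K i) (⋃ n : ℤ, (S ^ n) '' K j))
    {i j : ι} (hi : p i) (hj : p j) (h : IsZPowTranslate S (K i) (K j)) : i = j := by
  by_contra hij
  obtain ⟨m, hm⟩ := h
  obtain ⟨x, hx⟩ := hne i
  refine Set.disjoint_left.mp (hsat i j hi hj hij)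
    (Set.mem_iUnion.mpr ⟨0, by simpa using hx⟩) (Set.mem_iUnion.mpr ⟨m, hm ▸ hx⟩)

end IsZPowTranslate


/-- Under Hypothesis (H), the index maps `j₁, j₂, j₃` are
uniquely determined by the `K i`, the restrictions of `j₁` and `j₂` to
`{1,…,r}` are permutations of `{1,…,r}`, and `j₁ ∘ j₂ = j₂ ∘ j₁` on
`{1,…,q}`. (Indices are `Fin q`; the subset `{1,…,r}` is `{i | (i : ℕ) < r}`;
iterates `T₃ⁿ` are powers of the underlying permutation `T₃.toEquiv`.) -/
theorem stmt_8 {X : Type*} [TopologicalSpace X] [CompactSpace X] [T2Space X]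
    [TotallyDisconnectedSpace X] [Nonempty X] (hperf : Perfect (Set.univ : Set X))
    (T₁ T₂ T₃ : X ≃ₜ X)
    (h12 : ∀ x, T₁ (T₂ x) = T₂ (T₁ x)) (h13 : ∀ x, T₁ (T₃ x) = T₃ (T₁ x))
    (h23 : ∀ x, T₂ (T₃ x) = T₃ (T₂ x))
    (Λ : Set X) (hΛ : IsClopen Λ)
    (q r : ℕ) (hr : 1 ≤ r) (hrq : r ≤ q)
    (K : Fin q → Set X)
    (hKclopen : ∀ i, IsClopen (K i)) (hKne : ∀ i, (K i).Nonempty)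
    (hKdisj : ∀ i j : Fin q, i ≠ j → Disjoint (K i) (K j))
    (hKunion : Λ = ⋃ i, K i)
    (j₁ j₂ j₃ : Fin q → Fin q) (β : Fin q → ℤ)
    (hj₃lt : ∀ i, (j₃ i : ℕ) < r)
    (hj₃id : ∀ i : Fin q, (i : ℕ) < r → j₃ i = i ∧ β i = 0)
    (hβ : ∀ i, K i = (T₃.toEquiv ^ β i) '' K (j₃ i))
    (hsat : ∀ i j : Fin q, (i : ℕ) < r → (j : ℕ) < r → i ≠ j →
      Disjoint (⋃ n : ℤ, (T₃.toEquiv ^ n) '' K i) (⋃ n : ℤ, (T₃.toEquiv ^ n) '' K j))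
    (hj₁lt : ∀ i, (j₁ i : ℕ) < r)
    (hj₁ : ∀ i, ∃ m : ℤ, T₁ '' K i = (T₃.toEquiv ^ m) '' K (j₁ i))
    (hj₂lt : ∀ i, (j₂ i : ℕ) < r)
    (hj₂ : ∀ i, ∃ m : ℤ, T₂ '' K i = (T₃.toEquiv ^ m) '' K (j₂ i)) :
    (∀ j₁' : Fin q → Fin q, (∀ i, (j₁' i : ℕ) < r) →
      (∀ i, ∃ m : ℤ, T₁ '' K i = (T₃.toEquiv ^ m) '' K (j₁' i)) → j₁' = j₁) ∧
    (∀ j₂' : Fin q → Fin q, (∀ i, (j₂' i : ℕ) < r) →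
      (∀ i, ∃ m : ℤ, T₂ '' K i = (T₃.toEquiv ^ m) '' K (j₂' i)) → j₂' = j₂) ∧
    (∀ (j₃' : Fin q → Fin q) (β' : Fin q → ℤ), (∀ i, (j₃' i : ℕ) < r) →
      (∀ i : Fin q, (i : ℕ) < r → j₃' i = i ∧ β' i = 0) →
      (∀ i, K i = (T₃.toEquiv ^ β' i) '' K (j₃' i)) → j₃' = j₃) ∧
    Set.BijOn j₁ {i : Fin q | (i : ℕ) < r} {i : Fin q | (i : ℕ) < r} ∧
    Set.BijOn j₂ {i : Fin q | (i : ℕ) < r} {i : Fin q | (i : ℕ) < r} ∧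
    (∀ i : Fin q, j₁ (j₂ i) = j₂ (j₁ i)) := by
  have c12 : Commute T₁.toEquiv T₂.toEquiv := Equiv.ext h12
  have c13 : Commute T₁.toEquiv T₃.toEquiv := Equiv.ext h13
  have c23 : Commute T₂.toEquiv T₃.toEquiv := Equiv.ext h23
  have key : ∀ {i j : Fin q}, (i : ℕ) < r → (j : ℕ) < r →
      IsZPowTranslate T₃.toEquiv (K i) (K j) → i = j := fun hi hj h =>
    h.eq_of_disjoint_saturations hKne hsat hi hj
  have t₁ : ∀ i, IsZPowTranslate T₃.toEquiv (T₁.toEquiv '' K i) (K (j₁ i)) := hj₁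
  have t₂ : ∀ i, IsZPowTranslate T₃.toEquiv (T₂.toEquiv '' K i) (K (j₂ i)) := hj₂
  have bij : ∀ {T : Equiv.Perm X} {j : Fin q → Fin q}, Commute T T₃.toEquiv →
      (∀ i, (j i : ℕ) < r) → (∀ i, IsZPowTranslate T₃.toEquiv (T '' K i) (K (j i))) →
      Set.BijOn j {i : Fin q | (i : ℕ) < r} {i : Fin q | (i : ℕ) < r} := by
    intro T j hT hlt ht
    have hinj : Set.InjOn j {i : Fin q | (i : ℕ) < r} := fun a ha b hb hab =>
      key ha hb (((ht a).trans (hab ▸ (ht b).symm)).of_image hT)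
    exact (Set.toFinite _).injOn_iff_bijOn_of_mapsTo (fun i _ => hlt i) |>.mp hinj
  refine ⟨fun j hlt h => ?_, fun j hlt h => ?_, fun j b hlt _ h => ?_,
    bij c13 hj₁lt t₁, bij c23 hj₂lt t₂, fun i => ?_⟩
  · exact funext fun i => key (hlt i) (hj₁lt i) (IsZPowTranslate.symm (h i) |>.trans (t₁ i))
  · exact funext fun i => key (hlt i) (hj₂lt i) (IsZPowTranslate.symm (h i) |>.trans (t₂ i))
  · exact funext fun i => key (hlt i) (hj₃lt i)
      (IsZPowTranslate.symm ⟨b i, h i⟩ |>.trans ⟨β i, hβ i⟩)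
  · have h : T₁.toEquiv '' (T₂.toEquiv '' K i) = T₂.toEquiv '' (T₁.toEquiv '' K i) := by
      simp only [← Set.image_comp, ← Equiv.Perm.coe_mul, c12.eq]
    have e₁ := ((t₂ i).image c13).trans (t₁ (j₂ i))
    have e₂ := ((t₁ i).image c23).trans (t₂ (j₁ i))
    exact key (hj₁lt _) (hj₂lt _) (e₁.symm.trans (h ▸ e₂))
end

section
/- Suppose Λ satisfies Hypothesis (H) with data K₁, …, K_q, r, j₁, j₂, j₃, β. Then there exist maps k₁, k₂ : {1,…,q} → ℤ such that for every i ∈ {1,…,q}: (i) T₁(T₃^{-k₁(i)}(K_i)) = K_{j₁(i)} and T₂(T₃^{-k₂(i)}(K_i)) = K_{j₂(i)}; and (ii) k₂(j₁(i)) − k₂(i) = k₁(j₂(i)) − k₁(i). -/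
/-- An integer-valued function on a finite set that is orthogonal to all functions invariant under
two permutations `σ`, `τ` is the sum of a `σ`-coboundary and a `τ`-coboundary. -/
theorem exists_coboundary_add_coboundary {ι : Type*} [Fintype ι] [DecidableEq ι]
    (σ τ : Equiv.Perm ι) (e : ι → ℤ)
    (he : ∀ w : ι → ℚ, (∀ i, w (σ i) = w i) → (∀ i, w (τ i) = w i) → ∑ i, w i * e i = 0) :
    ∃ a b : ι → ℤ, ∀ i, e i = (a (σ i) - a i) + (b (τ i) - b i) := by
  let M : AddSubgroup (ι → ℤ) :=
    { carrier := {e | ∃ a b : ι → ℤ, ∀ i, e i = (a (σ i) - a i) + (b (τ i) - b i)}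
      zero_mem' := ⟨0, 0, by simp⟩
      add_mem' := by
        rintro _ _ ⟨a, b, h⟩ ⟨a', b', h'⟩
        refine ⟨a + a', b + b', fun i => ?_⟩
        simp only [Pi.add_apply, h, h']
        ring
      neg_mem' := by
        rintro _ ⟨a, b, h⟩
        refine ⟨-a, -b, fun i => ?_⟩
        simp only [Pi.neg_apply, h]
        ring }
  let s : Setoid ι := Relation.EqvGen.setoid fun i j => j = σ i ∨ j = τ i
  let rep : ι → ι := fun i => (Quotient.mk s i).out
  have single_sub_mem : ∀ i j, s i j →
      (Pi.single i 1 - Pi.single j 1 : ι → ℤ) ∈ M := by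
    intro i j hij
    induction hij with
    | rel i j h =>
      rcases h with rfl | rfl
      · exact ⟨Pi.single (σ i) 1, 0, fun x => by simp [Pi.single_apply]⟩
      · exact ⟨0, Pi.single (τ i) 1, fun x => by simp [Pi.single_apply]⟩
    | refl i => simp [M.zero_mem]
    | symm i j _ h => simpa using M.neg_mem h
    | trans i j k _ _ h h' => simpa using M.add_mem h h'
  have rep_eq : ∀ i j, s i j → rep i = rep j := fun i j h =>
    congrArg Quotient.out (Quotient.sound h)
  have sum_rep : ∑ i, e i • (Pi.single (rep i) 1 : ι → ℤ) = 0 := by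
    funext x
    have h := he (fun i => if rep i = x then 1 else 0)
      (fun i => by rw [← rep_eq i (σ i) (.rel _ _ (Or.inl rfl))])
      (fun i => by rw [← rep_eq i (τ i) (.rel _ _ (Or.inr rfl))])
    simp only [ite_mul, one_mul, zero_mul] at h
    simp only [Finset.sum_apply, Pi.smul_apply, Pi.single_apply, smul_eq_mul, mul_ite, mul_one,
      mul_zero, Pi.zero_apply, eq_comm (a := x)]
    exact_mod_cast h
  have sum_single : ∑ i, e i • (Pi.single i 1 : ι → ℤ) = e := by
    funext x
    simp [Finset.sum_apply, Pi.single_apply]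
  have mem : ∑ i, e i • (Pi.single i 1 - Pi.single (rep i) 1 : ι → ℤ) ∈ M :=
    M.sum_mem fun i _ => M.zsmul_mem
      (single_sub_mem _ _ (Setoid.symm (Quotient.mk_out (s := s) i))) _
  simp only [smul_sub, Finset.sum_sub_distrib, sum_rep, sum_single, sub_zero] at mem
  exact mem

/-- If commuting elements `g₁`, `g₂` permute finitely many points lying in distinct orbits of
an element `t` commuting with both, up to powers of `t`, then these powers can be chosen to satisfy
the cocycle identity exactly, even when some of the points are periodic under `t`. -/
theorem exists_zpow_cocycle {G α ι : Type*} [Group G] [MulAction G α] [Finite ι]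
    {g₁ g₂ t : G} (h₁₂ : Commute g₁ g₂) (h₁ : Commute g₁ t) (h₂ : Commute g₂ t)
    (K : ι → α) (hK : ∀ i j (n : ℤ), K i = t ^ n • K j → i = j) (j₁ j₂ : ι → ι)
    (hj₁ : ∀ i, ∃ m : ℤ, g₁ • K i = t ^ m • K (j₁ i))
    (hj₂ : ∀ i, ∃ m : ℤ, g₂ • K i = t ^ m • K (j₂ i)) :
    ∃ k₁ k₂ : ι → ℤ, (∀ i, g₁ • K i = t ^ k₁ i • K (j₁ i)) ∧
      (∀ i, g₂ • K i = t ^ k₂ i • K (j₂ i)) ∧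
      ∀ i, k₂ (j₁ i) - k₂ i = k₁ (j₂ i) - k₁ i := by
  classical
  have := Fintype.ofFinite ι
  have swap {g : G} (h : Commute g t) (n : ℤ) (x : α) : g • t ^ n • x = t ^ n • g • x := by
    rw [smul_smul, (h.zpow_right n).eq, mul_smul]
  have inj {g : G} (h : Commute g t) {j : ι → ι} {m : ι → ℤ}
      (hm : ∀ i, g • K i = t ^ m i • K (j i)) : Function.Injective j := by
    intro i i' hii
    refine hK i i' (m i - m i') (MulAction.injective g ?_)
    change g • K i = g • _
    rw [swap h, hm, hm, hii, smul_smul, ← zpow_add, sub_add_cancel]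
  let p : ι → ℕ := fun i => Function.minimalPeriod (t • ·) (K i)
  have p_dvd (i : ι) (n : ℤ) : (p i : ℤ) ∣ n ↔ t ^ n • K i = K i :=
    MulAction.zpow_smul_eq_iff_minimalPeriod_dvd.symm
  have p_inv {g : G} (h : Commute g t) {j : ι → ι} {m : ι → ℤ}
      (hm : ∀ i, g • K i = t ^ m i • K (j i)) (i : ι) : p (j i) = p i := by
    have key (n : ℤ) : (p (j i) : ℤ) ∣ n ↔ (p i : ℤ) ∣ n := by
      rw [p_dvd, p_dvd, ← smul_left_cancel_iff g (x := t ^ n • K i), swap h, hm, smul_smul,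
        ← zpow_add, add_comm, zpow_add, mul_smul, smul_left_cancel_iff]
    exact Nat.dvd_antisymm (Int.natCast_dvd_natCast.1 ((key _).2 dvd_rfl))
      (Int.natCast_dvd_natCast.1 ((key _).1 dvd_rfl))
  choose m₁ hm₁ using hj₁
  choose m₂ hm₂ using hj₂
  let σ : Equiv.Perm ι := .ofBijective j₁ (Finite.injective_iff_bijective.1 (inj h₁ hm₁))
  let τ : Equiv.Perm ι := .ofBijective j₂ (Finite.injective_iff_bijective.1 (inj h₂ hm₂))
  let d : ι → ℤ := fun i => m₁ i + m₂ (σ i) - (m₂ i + m₁ (τ i))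
  have p_dvd_d (i : ι) : (p i : ℤ) ∣ d i := by
    have e₁ : g₂ • g₁ • K i = t ^ (m₁ i + m₂ (j₁ i)) • K (j₂ (j₁ i)) := by
      rw [hm₁, swap h₂, hm₂, smul_smul, ← zpow_add]
    have e₂ : g₂ • g₁ • K i = t ^ (m₂ i + m₁ (j₂ i)) • K (j₁ (j₂ i)) := by
      rw [smul_smul, ← h₁₂.eq, mul_smul, hm₂, swap h₁, hm₁, smul_smul, ← zpow_add]
    have e : t ^ d i • K (j₂ (j₁ i)) = K (j₁ (j₂ i)) := by
      change t ^ (m₁ i + m₂ (j₁ i) - (m₂ i + m₁ (j₂ i))) • _ = _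
      rw [sub_eq_neg_add, zpow_add, mul_smul, ← e₁, e₂, zpow_neg, inv_smul_smul]
    rw [← hK _ _ _ e.symm, ← p_dvd, p_inv h₁ hm₁, p_inv h₂ hm₂] at e
    exact e
  obtain ⟨a, b, hab⟩ := exists_coboundary_add_coboundary σ τ (fun i => d i / p i) (by
    intro w hσ hτ
    let w' : ι → ℚ := fun i => w i / p i
    have hw'σ (i : ι) : w' (σ i) = w' i :=
      congrArg₂ (fun (x : ℚ) (n : ℕ) => x / n) (hσ i) (p_inv h₁ hm₁ i)
    have hw'τ (i : ι) : w' (τ i) = w' i :=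
      congrArg₂ (fun (x : ℚ) (n : ℕ) => x / n) (hτ i) (p_inv h₂ hm₂ i)
    have hσ_sum := Equiv.sum_comp σ fun i => w' i * (m₂ i : ℚ)
    have hτ_sum := Equiv.sum_comp τ fun i => w' i * (m₁ i : ℚ)
    simp only [hw'σ, hw'τ] at hσ_sum hτ_sum
    have hd (i : ι) : w i * ((d i / p i : ℤ) : ℚ) =
        (w' i * m₁ i + w' i * m₂ (σ i)) - (w' i * m₂ i + w' i * m₁ (τ i)) := by
      rw [Int.cast_div_charZero (p_dvd_d i)]
      simp only [d, w']
      push_cast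
      ring
    simp only [hd, Finset.sum_sub_distrib, Finset.sum_add_distrib, hσ_sum, hτ_sum]
    ring)
  have smul_period (i : ι) (m n : ℤ) : t ^ (m + p i * n) • K i = t ^ m • K i := by
    rw [zpow_add, mul_smul, (p_dvd i _).1 (dvd_mul_right _ _)]
  refine ⟨fun i => m₁ i + p i * b i, fun i => m₂ i + p i * -a i, fun i => ?_, fun i => ?_,
    fun i => ?_⟩
  · simp only [← p_inv h₁ hm₁ i, smul_period, hm₁]
  · simp only [← p_inv h₂ hm₂ i, smul_period, hm₂]
  · have h := hab i
    have hd : d i = p i * (d i / p i) := (Int.mul_ediv_cancel' (p_dvd_d i)).symm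
    simp only [h] at hd
    simp only [p_inv h₁ hm₁, p_inv h₂ hm₂]
    change m₁ i + m₂ (j₁ i) - (m₂ i + m₁ (j₂ i)) =
      p i * ((a (j₁ i) - a i) + (b (j₂ i) - b i)) at hd
    linear_combination hd

open scoped Pointwise in

/-- Under Hypothesis (H), there exist `k₁, k₂ : {1,…,q} → ℤ`
such that for every `i`: (i) `T₁(T₃^{-k₁(i)}(K_i)) = K_{j₁(i)}` and
`T₂(T₃^{-k₂(i)}(K_i)) = K_{j₂(i)}`; (ii) `k₂(j₁(i)) − k₂(i) = k₁(j₂(i)) − k₁(i)`. -/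
theorem stmt_10 {X : Type*} [TopologicalSpace X] [CompactSpace X] [T2Space X]
    [TotallyDisconnectedSpace X] [Nonempty X] (hperf : Perfect (Set.univ : Set X))
    (T₁ T₂ T₃ : X ≃ₜ X)
    (h12 : ∀ x, T₁ (T₂ x) = T₂ (T₁ x)) (h13 : ∀ x, T₁ (T₃ x) = T₃ (T₁ x))
    (h23 : ∀ x, T₂ (T₃ x) = T₃ (T₂ x))
    (Λ : Set X) (hΛ : IsClopen Λ)
    (q r : ℕ) (hr : 1 ≤ r) (hrq : r ≤ q)
    (K : Fin q → Set X)
    (hKclopen : ∀ i, IsClopen (K i)) (hKne : ∀ i, (K i).Nonempty)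
    (hKdisj : ∀ i j : Fin q, i ≠ j → Disjoint (K i) (K j))
    (hKunion : Λ = ⋃ i, K i)
    (j₁ j₂ j₃ : Fin q → Fin q) (β : Fin q → ℤ)
    (hj₃lt : ∀ i, (j₃ i : ℕ) < r)
    (hj₃id : ∀ i : Fin q, (i : ℕ) < r → j₃ i = i ∧ β i = 0)
    (hβ : ∀ i, K i = (T₃.toEquiv ^ β i) '' K (j₃ i))
    (hsat : ∀ i j : Fin q, (i : ℕ) < r → (j : ℕ) < r → i ≠ j →
      Disjoint (⋃ n : ℤ, (T₃.toEquiv ^ n) '' K i) (⋃ n : ℤ, (T₃.toEquiv ^ n) '' K j))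
    (hj₁lt : ∀ i, (j₁ i : ℕ) < r)
    (hj₁ : ∀ i, ∃ m : ℤ, T₁ '' K i = (T₃.toEquiv ^ m) '' K (j₁ i))
    (hj₂lt : ∀ i, (j₂ i : ℕ) < r)
    (hj₂ : ∀ i, ∃ m : ℤ, T₂ '' K i = (T₃.toEquiv ^ m) '' K (j₂ i))
    :
    ∃ k₁ k₂ : Fin q → ℤ, ∀ i : Fin q,
      T₁ '' ((T₃.toEquiv ^ (-(k₁ i))) '' K i) = K (j₁ i) ∧
      T₂ '' ((T₃.toEquiv ^ (-(k₂ i))) '' K i) = K (j₂ i) ∧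
      k₂ (j₁ i) - k₂ i = k₁ (j₂ i) - k₁ i := by
  let g₁ : Equiv.Perm X := T₁.toEquiv
  let g₂ : Equiv.Perm X := T₂.toEquiv
  let t : Equiv.Perm X := T₃.toEquiv
  have c₁₂ : Commute g₁ g₂ := Equiv.ext h12
  have c₁ : Commute g₁ t := Equiv.ext h13
  have c₂ : Commute g₂ t := Equiv.ext h23
  have swap {g : Equiv.Perm X} (h : Commute g t) (n : ℤ) (S : Set X) :
      g • t ^ n • S = t ^ n • g • S := by
    rw [smul_smul, (h.zpow_right n).eq, mul_smul]
  have K_eq (i : Fin q) : K i = t ^ β i • K (j₃ i) := hβ i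
  have orbit_unique {i j : Fin q} (hi : (i : ℕ) < r) (hj : (j : ℕ) < r) (m n : ℤ)
      (h : t ^ m • K i = t ^ n • K j) : i = j := by
    by_contra hij
    obtain ⟨x, hx⟩ := (hKne i).smul_set (a := t ^ m)
    exact Set.disjoint_left.1 (hsat i j hi hj hij) (Set.mem_iUnion.2 ⟨m, hx⟩)
      (Set.mem_iUnion.2 ⟨n, h.subset hx⟩)
  obtain ⟨k₁, k₂, hk₁, hk₂, hk⟩ := exists_zpow_cocycle c₁₂ c₁ c₂
    (fun i : {i : Fin q // (i : ℕ) < r} => K i)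
    (fun i j n hn => Subtype.ext (orbit_unique i.2 j.2 0 n (by simpa using hn)))
    (fun i => ⟨j₁ i, hj₁lt i⟩) (fun i => ⟨j₂ i, hj₂lt i⟩)
    (fun i => hj₁ i) (fun i => hj₂ i)
  let s : Fin q → {i : Fin q // (i : ℕ) < r} := fun i => ⟨j₃ i, hj₃lt i⟩
  have j_eq {g : Equiv.Perm X} (h : Commute g t) {j : Fin q → Fin q} (hj : ∀ i, (j i : ℕ) < r)
      (hm : ∀ i, ∃ m : ℤ, g • K i = t ^ m • K (j i)) (i : Fin q) : j (j₃ i) = j i := by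
    obtain ⟨m, hi⟩ := hm i
    obtain ⟨n, hn⟩ := hm (j₃ i)
    rw [K_eq i, swap h, hn, smul_smul, ← zpow_add] at hi
    exact orbit_unique (hj _) (hj _) _ _ hi
  have smul_eq {g : Equiv.Perm X} (h : Commute g t) {j : Fin q → Fin q}
      {k : {i : Fin q // (i : ℕ) < r} → ℤ} (hj : ∀ i, j (j₃ i) = j i)
      (hg : ∀ i : {i : Fin q // (i : ℕ) < r}, g • K i = t ^ k i • K (j i)) (i : Fin q) :
      g • t ^ (-(k (s i) + β i)) • K i = K (j i) := by
    rw [swap h, K_eq i, swap h, hg (s i), ← hj i, smul_smul, smul_smul, ← zpow_add, ← zpow_add,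
      show -(k (s i) + β i) + β i + k (s i) = 0 by ring, zpow_zero, one_smul]
  have s_eq (i : Fin q) (hi : (i : ℕ) < r) : s i = ⟨i, hi⟩ := Subtype.ext (hj₃id i hi).1
  refine ⟨fun i => k₁ (s i) + β i, fun i => k₂ (s i) + β i, fun i =>
    ⟨smul_eq c₁ (j_eq c₁ hj₁lt hj₁) hk₁ i, smul_eq c₂ (j_eq c₂ hj₂lt hj₂) hk₂ i, ?_⟩⟩
  have h := hk (s i)
  simp only [s, j_eq c₁ hj₁lt hj₁, j_eq c₂ hj₂lt hj₂] at h
  simp only [s_eq _ (hj₁lt i), s_eq _ (hj₂lt i), (hj₃id _ (hj₁lt i)).2, (hj₃id _ (hj₂lt i)).2]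
  simp only [s]
  linear_combination h
end

section
/- Suppose Λ satisfies Hypothesis (H) with data K₁, …, K_q, r, j₁, j₂, j₃, β, and suppose k₁, k₂ : {1,…,r} → ℤ satisfy, for all i ∈ {1,…,r}: T₁(T₃^{-k₁(i)}(K_i)) = K_{j₁(i)}, T₂(T₃^{-k₂(i)}(K_i)) = K_{j₂(i)}, and k₂(j₁(i)) − k₂(i) = k₁(j₂(i)) − k₁(i). Extend k₁ and k₂ to {1,…,q} by setting k₁(i) := k₁(j₃(i)) + β_i and k₂(i) := k₂(j₃(i)) + β_i for r+1 ≤ i ≤ q. Then the extended maps satisfy, for all i ∈ {1,…,q}: T₁(T₃^{-k₁(i)}(K_i)) = K_{j₁(i)}, T₂(T₃^{-k₂(i)}(K_i)) = K_{j₂(i)}, and k₂(j₁(i)) − k₂(i) = k₁(j₂(i)) − k₁(i). -/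
theorem Equiv.Perm.image_zpow_image_zpow {X : Type*} (S : Equiv.Perm X) (m n : ℤ) (A : Set X) :
    (S ^ m) '' ((S ^ n) '' A) = (S ^ (m + n)) '' A := by
  rw [zpow_add, Equiv.Perm.coe_mul, Set.image_comp]

theorem Equiv.Perm.image_image_zpow_comm {X : Type*} {T S : Equiv.Perm X} (h : Commute T S)
    (n : ℤ) (A : Set X) : T '' ((S ^ n) '' A) = (S ^ n) '' (T '' A) := by
  rw [← Set.image_comp, ← Set.image_comp, ← Equiv.Perm.coe_mul, ← Equiv.Perm.coe_mul,
    (h.zpow_right n).eq]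

/-- If the `S`-saturations of `K a` and `K b` are disjoint whenever `a ≠ b`, then `a = b` as soon as
some `S`-translates of `K a` and `K b` coincide. -/
theorem Equiv.Perm.eq_of_image_zpow_eq {X ι : Type*} (S : Equiv.Perm X) {K : ι → Set X} {a b : ι}
    (hne : (K a).Nonempty)
    (hdisj : a ≠ b → _root_.Disjoint (⋃ n : ℤ, (S ^ n) '' K a) (⋃ n : ℤ, (S ^ n) '' K b))
    {m n : ℤ} (h : (S ^ m) '' K a = (S ^ n) '' K b) : a = b := by
  by_contra hab
  obtain ⟨x, hx⟩ := hne.image (S ^ m)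
  exact Set.disjoint_left.1 (hdisj hab) (Set.mem_iUnion.2 ⟨m, hx⟩)
    (Set.mem_iUnion.2 ⟨n, h ▸ hx⟩)

/-- If `T` commutes with `S` and carries a translate of `K i'` onto `K (j i')`, then it carries the
corresponding translate of `K i = S ^ b '' K i'` onto `K (j i)`, and `j i = j i'`. -/
theorem Equiv.Perm.image_zpow_neg_add_eq {X ι : Type*} {T S : Equiv.Perm X} (hTS : Commute T S)
    {K : ι → Set X} {j : ι → ι} {i i' : ι} {b k : ℤ} (hne : (K (j i)).Nonempty)
    (hK : K i = (S ^ b) '' K i')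
    (hdisj : j i ≠ j i' →
      _root_.Disjoint (⋃ n : ℤ, (S ^ n) '' K (j i)) (⋃ n : ℤ, (S ^ n) '' K (j i')))
    (hj : ∃ m : ℤ, T '' K i = (S ^ m) '' K (j i))
    (hk : T '' ((S ^ (-k)) '' K i') = K (j i')) :
    j i = j i' ∧ T '' ((S ^ (-(k + b))) '' K i) = K (j i) := by
  obtain ⟨m, hm⟩ := hj
  have key : T '' ((S ^ (-(k + b))) '' K i) = K (j i') := by
    rw [hK, image_zpow_image_zpow, ← hk]
    congr 4
    ring
  have hjj : j i = j i' := by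
    refine eq_of_image_zpow_eq S (m := -(k + b) + m) (n := 0) hne hdisj ?_
    rw [← image_zpow_image_zpow, ← hm, ← image_image_zpow_comm hTS, key]
    simp
  exact ⟨hjj, hjj ▸ key⟩

/-- Under Hypothesis (H), suppose `k₁, k₂` satisfy the
conditions `T₁(T₃^{-k₁(i)}(K_i)) = K_{j₁(i)}`, `T₂(T₃^{-k₂(i)}(K_i)) = K_{j₂(i)}`
and `k₂(j₁(i)) − k₂(i) = k₁(j₂(i)) − k₁(i)` for all `i ∈ {1,…,r}`, and are
extended to `{1,…,q}` by `k₁(i) = k₁(j₃(i)) + β_i`, `k₂(i) = k₂(j₃(i)) + β_i`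
for `r+1 ≤ i ≤ q`. Then the extended maps satisfy the same three conditions
for all `i ∈ {1,…,q}`. -/
theorem stmt_11 {X : Type*} [TopologicalSpace X] [CompactSpace X] [T2Space X]
    [TotallyDisconnectedSpace X] [Nonempty X] (hperf : Perfect (Set.univ : Set X))
    (T₁ T₂ T₃ : X ≃ₜ X)
    (h12 : ∀ x, T₁ (T₂ x) = T₂ (T₁ x)) (h13 : ∀ x, T₁ (T₃ x) = T₃ (T₁ x))
    (h23 : ∀ x, T₂ (T₃ x) = T₃ (T₂ x))
    (Λ : Set X) (hΛ : IsClopen Λ)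
    (q r : ℕ) (hr : 1 ≤ r) (hrq : r ≤ q)
    (K : Fin q → Set X)
    (hKclopen : ∀ i, IsClopen (K i)) (hKne : ∀ i, (K i).Nonempty)
    (hKdisj : ∀ i j : Fin q, i ≠ j → Disjoint (K i) (K j))
    (hKunion : Λ = ⋃ i, K i)
    (j₁ j₂ j₃ : Fin q → Fin q) (β : Fin q → ℤ)
    (hj₃lt : ∀ i, (j₃ i : ℕ) < r)
    (hj₃id : ∀ i : Fin q, (i : ℕ) < r → j₃ i = i ∧ β i = 0)
    (hβ : ∀ i, K i = (T₃.toEquiv ^ β i) '' K (j₃ i))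
    (hsat : ∀ i j : Fin q, (i : ℕ) < r → (j : ℕ) < r → i ≠ j →
      Disjoint (⋃ n : ℤ, (T₃.toEquiv ^ n) '' K i) (⋃ n : ℤ, (T₃.toEquiv ^ n) '' K j))
    (hj₁lt : ∀ i, (j₁ i : ℕ) < r)
    (hj₁ : ∀ i, ∃ m : ℤ, T₁ '' K i = (T₃.toEquiv ^ m) '' K (j₁ i))
    (hj₂lt : ∀ i, (j₂ i : ℕ) < r)
    (hj₂ : ∀ i, ∃ m : ℤ, T₂ '' K i = (T₃.toEquiv ^ m) '' K (j₂ i))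
    (k₁ k₂ : Fin q → ℤ)
    (hk₁r : ∀ i : Fin q, (i : ℕ) < r → T₁ '' ((T₃.toEquiv ^ (-(k₁ i))) '' K i) = K (j₁ i))
    (hk₂r : ∀ i : Fin q, (i : ℕ) < r → T₂ '' ((T₃.toEquiv ^ (-(k₂ i))) '' K i) = K (j₂ i))
    (hkcompat : ∀ i : Fin q, (i : ℕ) < r → k₂ (j₁ i) - k₂ i = k₁ (j₂ i) - k₁ i)
    (hext : ∀ i : Fin q, r ≤ (i : ℕ) → k₁ i = k₁ (j₃ i) + β i ∧ k₂ i = k₂ (j₃ i) + β i) :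
    ∀ i : Fin q,
      T₁ '' ((T₃.toEquiv ^ (-(k₁ i))) '' K i) = K (j₁ i) ∧
      T₂ '' ((T₃.toEquiv ^ (-(k₂ i))) '' K i) = K (j₂ i) ∧
      k₂ (j₁ i) - k₂ i = k₁ (j₂ i) - k₁ i := by
  intro i
  rcases lt_or_ge (i : ℕ) r with hi | hi
  · exact ⟨hk₁r i hi, hk₂r i hi, hkcompat i hi⟩
  obtain ⟨e₁, e₂⟩ := hext i hi
  obtain ⟨hj₁eq, him₁⟩ := Equiv.Perm.image_zpow_neg_add_eq (T := T₁.toEquiv) (S := T₃.toEquiv)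
    (Equiv.ext h13) (hKne _) (hβ i) (hsat _ _ (hj₁lt _) (hj₁lt _)) (hj₁ i) (hk₁r _ (hj₃lt i))
  obtain ⟨hj₂eq, him₂⟩ := Equiv.Perm.image_zpow_neg_add_eq (T := T₂.toEquiv) (S := T₃.toEquiv)
    (Equiv.ext h23) (hKne _) (hβ i) (hsat _ _ (hj₂lt _) (hj₂lt _)) (hj₂ i) (hk₂r _ (hj₃lt i))
  refine ⟨e₁ ▸ him₁, e₂ ▸ him₂, ?_⟩
  have := hkcompat _ (hj₃lt i)
  rw [hj₁eq, hj₂eq, e₁, e₂]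
  linarith
end

section
/- There exists a unique family of maps K_{n₁,n₂} : ι → ℤ, indexed by (n₁, n₂) ∈ ℤ², such that K_{0,0} = 0 and, for all (n₁, n₂) ∈ ℤ² and all i ∈ ι, K_{n₁,n₂+1}(i) = K_{n₁,n₂}(j₂(i)) + k₂(i) and K_{n₁+1,n₂}(i) = K_{n₁,n₂}(j₁(i)) + k₁(i). Moreover this family satisfies K_{1,0} = k₁, K_{0,1} = k₂, and the cocycle identity K_{m₁,m₂}(j₂^{n₂−m₂}(j₁^{n₁−m₁}(i))) + K_{n₁−m₁,n₂−m₂}(i) = K_{n₁,n₂}(i) for all integers n₁, n₂, m₁, m₂ and all i ∈ ι. -/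
/-- A `ℤ²`-indexed family which is transported by `j₁` and `j₂` and vanishes at the origin
is zero. -/
theorem eq_zero_of_equivariant {ι M : Type*} [Zero M] (j₁ j₂ : Equiv.Perm ι) (D : ℤ → ℤ → ι → M)
    (h0 : ∀ i, D 0 0 i = 0) (h2 : ∀ a b i, D a (b + 1) i = D a b (j₂ i))
    (h1 : ∀ a b i, D (a + 1) b i = D a b (j₁ i)) (a b : ℤ) (i : ι) : D a b i = 0 := by
  have h (a : ℤ) : ∀ i, D a 0 i = 0 := by
    induction a using Int.induction_on with
    | zero => exact h0
    | succ n ih => intro i; rw [h1, ih]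
    | pred n ih =>
      intro i
      have := h1 (-n - 1) 0 (j₁.symm i)
      rwa [sub_add_cancel, ih, j₁.apply_symm_apply, eq_comm] at this
  induction b using Int.induction_on generalizing i with
  | zero => exact h a i
  | succ n ih => rw [h2, ih]
  | pred n ih =>
    have := h2 a (-n - 1) (j₂.symm i)
    rwa [sub_add_cancel, ih, j₂.apply_symm_apply, eq_comm] at this

/-- The skew product `(i, x) ↦ (j i, x + k i)` on `ι × ℤ`. -/
def skewProduct {ι : Type*} (j : Equiv.Perm ι) (k : ι → ℤ) : Equiv.Perm (ι × ℤ) where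
  toFun p := (j p.1, p.2 + k p.1)
  invFun p := (j.symm p.1, p.2 - k (j.symm p.1))
  left_inv p := by simp
  right_inv p := by simp

theorem skewProduct_apply {ι : Type*} (j : Equiv.Perm ι) (k : ι → ℤ) (i : ι) (x : ℤ) :
    skewProduct j k (i, x) = (j i, x + k i) := rfl

theorem commute_skewProduct {ι : Type*} {j₁ j₂ : Equiv.Perm ι} (hcomm : Commute j₁ j₂)
    {k₁ k₂ : ι → ℤ} (hk : ∀ i, k₂ (j₁ i) - k₂ i = k₁ (j₂ i) - k₁ i) :
    Commute (skewProduct j₁ k₁) (skewProduct j₂ k₂) := by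
  ext1 ⟨i, x⟩
  have hj : j₁ (j₂ i) = j₂ (j₁ i) := DFunLike.congr_fun hcomm.eq i
  simp only [Equiv.Perm.mul_apply, skewProduct_apply, hj, Prod.mk.injEq, true_and]
  linarith [hk i]

/-- A permutation of `ι × ℤ` commuting with all translations of the fibres is determined by its
values on `ι × {0}`. -/
theorem snd_apply_of_commute_translation {ι : Type*} {T : Equiv.Perm (ι × ℤ)}
    (hT : ∀ c : ℤ, Commute T (skewProduct 1 fun _ => c)) (i : ι) (x : ℤ) :
    (T (i, x)).2 = (T (i, 0)).2 + x := by
  have h := congrArg Prod.snd (DFunLike.congr_fun (hT x).eq (i, 0))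
  simpa [skewProduct] using h

theorem exists_cocycle {ι : Type*} {j₁ j₂ : Equiv.Perm ι} (hcomm : Commute j₁ j₂)
    {k₁ k₂ : ι → ℤ} (hk : ∀ i, k₂ (j₁ i) - k₂ i = k₁ (j₂ i) - k₁ i) :
    ∃ F : ℤ → ℤ → ι → ℤ, F 0 0 = 0 ∧
      (∀ (n₁ n₂ : ℤ) (i : ι), F n₁ (n₂ + 1) i = F n₁ n₂ (j₂ i) + k₂ i) ∧
      (∀ (n₁ n₂ : ℤ) (i : ι), F (n₁ + 1) n₂ i = F n₁ n₂ (j₁ i) + k₁ i) := by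
  have hT := commute_skewProduct hcomm hk
  have htrans (a b c : ℤ) : Commute (skewProduct j₁ k₁ ^ a * skewProduct j₂ k₂ ^ b)
      (skewProduct 1 fun _ => c) :=
    ((commute_skewProduct (Commute.one_right j₁) (by simp)).zpow_left a).mul_left
      ((commute_skewProduct (Commute.one_right j₂) (by simp)).zpow_left b)
  refine ⟨fun a b i => ((skewProduct j₁ k₁ ^ a * skewProduct j₂ k₂ ^ b) (i, 0)).2,
    by ext; simp, fun a b i => ?_, fun a b i => ?_⟩
  · beta_reduce
    rw [zpow_add_one, ← mul_assoc, Equiv.Perm.mul_apply _ (skewProduct j₂ k₂), skewProduct_apply,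
      snd_apply_of_commute_translation (htrans a b), zero_add]
  · beta_reduce
    rw [zpow_add_one, mul_assoc, (hT.zpow_right b).eq, ← mul_assoc,
      Equiv.Perm.mul_apply _ (skewProduct j₁ k₁), skewProduct_apply,
      snd_apply_of_commute_translation (htrans a b), zero_add]

theorem cocycle_add {ι : Type*} {j₁ j₂ : Equiv.Perm ι} (hcomm : Commute j₁ j₂)
    {k₁ k₂ : ι → ℤ} {F : ℤ → ℤ → ι → ℤ} (h0 : F 0 0 = 0)
    (h2 : ∀ (n₁ n₂ : ℤ) (i : ι), F n₁ (n₂ + 1) i = F n₁ n₂ (j₂ i) + k₂ i)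
    (h1 : ∀ (n₁ n₂ : ℤ) (i : ι), F (n₁ + 1) n₂ i = F n₁ n₂ (j₁ i) + k₁ i)
    (m₁ m₂ a b : ℤ) (i : ι) :
    F (m₁ + a) (m₂ + b) i = F m₁ m₂ ((j₂ ^ b) ((j₁ ^ a) i)) + F a b i := by
  have h := eq_zero_of_equivariant j₁ j₂
    (fun a b i => F (m₁ + a) (m₂ + b) i - (F m₁ m₂ ((j₂ ^ b) ((j₁ ^ a) i)) + F a b i))
    (by simp [h0]) (fun a b i => ?_) (fun a b i => ?_) a b i
  · exact sub_eq_zero.mp h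
  · have hj : j₂ ((j₁ ^ a) i) = (j₁ ^ a) (j₂ i) :=
      DFunLike.congr_fun (hcomm.symm.zpow_right a).eq i
    simp only [← add_assoc, h2, zpow_add_one, Equiv.Perm.mul_apply, hj]
    ring
  · simp only [← add_assoc, h1, zpow_add_one, Equiv.Perm.mul_apply]
    ring

/-- Given commuting bijections `j₁, j₂` of a set `ι` and maps
`k₁, k₂ : ι → ℤ` with `k₂(j₁(i)) − k₂(i) = k₁(j₂(i)) − k₁(i)`, there is a
unique family `K_{n₁,n₂} : ι → ℤ` (`(n₁,n₂) ∈ ℤ²`) with `K_{0,0} = 0` and the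
recursions `K_{n₁,n₂+1}(i) = K_{n₁,n₂}(j₂(i)) + k₂(i)`,
`K_{n₁+1,n₂}(i) = K_{n₁,n₂}(j₁(i)) + k₁(i)`; moreover the family satisfies
`K_{1,0} = k₁`, `K_{0,1} = k₂` and the cocycle identity
`K_{m₁,m₂}(j₂^{n₂−m₂}(j₁^{n₁−m₁}(i))) + K_{n₁−m₁,n₂−m₂}(i) = K_{n₁,n₂}(i)`. -/
theorem stmt_12 {ι : Type*} (j₁ j₂ : Equiv.Perm ι) (hcomm : j₁ * j₂ = j₂ * j₁)
    (k₁ k₂ : ι → ℤ) (hk : ∀ i, k₂ (j₁ i) - k₂ i = k₁ (j₂ i) - k₁ i) :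
    (∃! F : ℤ → ℤ → ι → ℤ,
      F 0 0 = 0 ∧
      (∀ (n₁ n₂ : ℤ) (i : ι), F n₁ (n₂ + 1) i = F n₁ n₂ (j₂ i) + k₂ i) ∧
      (∀ (n₁ n₂ : ℤ) (i : ι), F (n₁ + 1) n₂ i = F n₁ n₂ (j₁ i) + k₁ i)) ∧
    (∀ F : ℤ → ℤ → ι → ℤ,
      (F 0 0 = 0 ∧
       (∀ (n₁ n₂ : ℤ) (i : ι), F n₁ (n₂ + 1) i = F n₁ n₂ (j₂ i) + k₂ i) ∧
       (∀ (n₁ n₂ : ℤ) (i : ι), F (n₁ + 1) n₂ i = F n₁ n₂ (j₁ i) + k₁ i)) →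
      F 1 0 = k₁ ∧ F 0 1 = k₂ ∧
      ∀ (m₁ m₂ n₁ n₂ : ℤ) (i : ι),
        F m₁ m₂ ((j₂ ^ (n₂ - m₂)) ((j₁ ^ (n₁ - m₁)) i)) + F (n₁ - m₁) (n₂ - m₂) i
          = F n₁ n₂ i) := by
  refine ⟨?_, ?_⟩
  · obtain ⟨F, hF0, hF2, hF1⟩ := exists_cocycle hcomm hk
    refine ⟨F, ⟨hF0, hF2, hF1⟩, ?_⟩
    rintro G ⟨hG0, hG2, hG1⟩
    funext a b i
    exact sub_eq_zero.mp <| eq_zero_of_equivariant j₁ j₂ (fun a b i => G a b i - F a b i)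
      (by simp [hF0, hG0]) (by simp [hF2, hG2]) (by simp [hF1, hG1]) a b i
  · rintro F ⟨h0, h2, h1⟩
    refine ⟨?_, ?_, fun m₁ m₂ n₁ n₂ i => ?_⟩
    · ext i
      simpa [h0] using h1 0 0 i
    · ext i
      simpa [h0] using h2 0 0 i
    · rw [← cocycle_add hcomm h0 h2 h1, add_sub_cancel, add_sub_cancel]
end

section
/- For all integers n₁ ≥ 1, n₂ ≥ 1 and all i ∈ ι one has Σ_{l=0}^{n₂−1} k₂(j₂^l(j₁^{n₁}(i))) + Σ_{l=0}^{n₁−1} k₁(j₁^l(i)) = Σ_{l=0}^{n₁−1} k₁(j₁^l(j₂^{n₂}(i))) + Σ_{l=0}^{n₂−1} k₂(j₂^l(i)). -/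
/-- For commuting bijections `j₁, j₂` of `ι` and maps
`k₁, k₂ : ι → ℤ` with `k₂(j₁(i)) − k₂(i) = k₁(j₂(i)) − k₁(i)`, for all
`n₁, n₂ ≥ 1` and all `i`:
`Σ_{l<n₂} k₂(j₂^l(j₁^{n₁}(i))) + Σ_{l<n₁} k₁(j₁^l(i))
 = Σ_{l<n₁} k₁(j₁^l(j₂^{n₂}(i))) + Σ_{l<n₂} k₂(j₂^l(i))`. -/
theorem stmt_13 {ι : Type*} (j₁ j₂ : Equiv.Perm ι) (hcomm : j₁ * j₂ = j₂ * j₁)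
    (k₁ k₂ : ι → ℤ) (hk : ∀ i, k₂ (j₁ i) - k₂ i = k₁ (j₂ i) - k₁ i) :
    ∀ (n₁ n₂ : ℕ), 1 ≤ n₁ → 1 ≤ n₂ → ∀ i : ι,
      (∑ l ∈ Finset.range n₂, k₂ ((j₂ ^ l) ((j₁ ^ n₁) i))) +
        (∑ l ∈ Finset.range n₁, k₁ ((j₁ ^ l) i)) =
      (∑ l ∈ Finset.range n₁, k₁ ((j₁ ^ l) ((j₂ ^ n₂) i))) +
        (∑ l ∈ Finset.range n₂, k₂ ((j₂ ^ l) i)) := by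
  intro n₁ n₂ _ _ i
  have hpow (l m : ℕ) (x : ι) : (j₂ ^ l) ((j₁ ^ m) x) = (j₁ ^ m) ((j₂ ^ l) x) := by
    have h : j₁ ^ m * j₂ ^ l = j₂ ^ l * j₁ ^ m := Commute.pow_pow hcomm m l
    exact (DFunLike.congr_fun h x).symm
  have htel₂ : ∑ l ∈ Finset.range n₂, ∑ m ∈ Finset.range n₁,
      (k₂ ((j₁ ^ (m + 1)) ((j₂ ^ l) i)) - k₂ ((j₁ ^ m) ((j₂ ^ l) i))) =
      ∑ l ∈ Finset.range n₂, (k₂ ((j₂ ^ l) ((j₁ ^ n₁) i)) - k₂ ((j₂ ^ l) i)) := by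
    refine Finset.sum_congr rfl fun l _ => ?_
    rw [Finset.sum_range_sub (fun m => k₂ ((j₁ ^ m) ((j₂ ^ l) i))), hpow]
    simp
  have htel₁ : ∑ m ∈ Finset.range n₁, ∑ l ∈ Finset.range n₂,
      (k₁ ((j₁ ^ m) ((j₂ ^ (l + 1)) i)) - k₁ ((j₁ ^ m) ((j₂ ^ l) i))) =
      ∑ m ∈ Finset.range n₁, (k₁ ((j₁ ^ m) ((j₂ ^ n₂) i)) - k₁ ((j₁ ^ m) i)) := by
    refine Finset.sum_congr rfl fun m _ => ?_
    rw [Finset.sum_range_sub (fun l => k₁ ((j₁ ^ m) ((j₂ ^ l) i)))]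
    simp
  have hcell (l m : ℕ) :
      k₂ ((j₁ ^ (m + 1)) ((j₂ ^ l) i)) - k₂ ((j₁ ^ m) ((j₂ ^ l) i)) =
      k₁ ((j₁ ^ m) ((j₂ ^ (l + 1)) i)) - k₁ ((j₁ ^ m) ((j₂ ^ l) i)) := by
    have h := hpow 1 m ((j₂ ^ l) i)
    rw [pow_one] at h
    rw [pow_succ' j₁, pow_succ' j₂, Equiv.Perm.mul_apply, Equiv.Perm.mul_apply, hk, h]
  simp only [hcell] at htel₂
  rw [Finset.sum_comm, htel₁, Finset.sum_sub_distrib, Finset.sum_sub_distrib] at htel₂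
  linarith
end

section
/- Suppose Λ satisfies Hypothesis (H) with data K₁, …, K_q, r, j₁, j₂, j₃, β, and let k₁, k₂ : {1,…,q} → ℤ satisfy: T₁(T₃^{-k₁(i)}(K_i)) = K_{j₁(i)}, T₂(T₃^{-k₂(i)}(K_i)) = K_{j₂(i)}, k₂(j₁(i)) − k₂(i) = k₁(j₂(i)) − k₁(i) for all i ∈ {1,…,q}, and k₁(i) = k₁(j₃(i)) + β_i, k₂(i) = k₂(j₃(i)) + β_i for r+1 ≤ i ≤ q. Let ĵ₁, ĵ₂ denote the commuting permutations of {1,…,r} obtained by restricting j₁, j₂. Then there is a unique family of maps K_{n₁,n₂} : {1,…,q} → ℤ, indexed by (n₁, n₂) ∈ ℤ², with K_{0,0}(i) = β_i and satisfying, for all (n₁, n₂) ∈ ℤ² and all i, the recursions K_{n₁,n₂+1}(i) = K_{n₁,n₂}(j₂(i)) + k₂(i) and K_{n₁+1,n₂}(i) = K_{n₁,n₂}(j₁(i)) + k₁(i); and this family satisfies: (1) T₁^{n₁} T₂^{n₂} T₃^{−K_{n₁,n₂}(i)}(K_i) = K_{ĵ₂^{n₂}(ĵ₁^{n₁}(j₃(i)))}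 for all (n₁, n₂) ∈ ℤ² and all i ∈ {1,…,q}; (2) K_{m₁,m₂}(ĵ₂^{n₂−m₂}(ĵ₁^{n₁−m₁}(j₃(i)))) + K_{n₁−m₁,n₂−m₂}(i) = K_{n₁,n₂}(i) for all integers m₁, m₂, n₁, n₂ and all i ∈ {1,…,q}. -/
open scoped Pointwise

/-- A family indexed by `ℤ` whose shift is precomposition with a permutation `e` is obtained
from its member at `0` by precomposition with powers of `e`. -/
theorem eq_zero_comp_zpow {A B : Type*} (e : Equiv.Perm A) (g : ℤ → A → B)
    (h : ∀ n a, g (n + 1) a = g n (e a)) (n : ℤ) (a : A) : g n a = g 0 ((e ^ n) a) := by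
  induction n generalizing a with
  | zero => simp
  | succ n ih => rw [h, ih, zpow_add_one, Equiv.Perm.mul_apply]
  | pred n ih =>
    have h' := h (-(n : ℤ) - 1) (e⁻¹ a)
    rw [sub_add_cancel, ← Equiv.Perm.mul_apply, mul_inv_cancel, Equiv.Perm.one_apply] at h'
    rw [← h', ih, zpow_sub_one, Equiv.Perm.mul_apply]

/-- The skew product over a permutation `P` with integer cocycle `k`. -/
def skewPerm {S : Type*} (P : Equiv.Perm S) (k : S → ℤ) : Equiv.Perm (S × ℤ) where
  toFun p := (P p.1, p.2 + k p.1)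
  invFun p := (P.symm p.1, p.2 - k (P.symm p.1))
  left_inv p := by simp
  right_inv p := by simp

theorem skewPerm_apply {S : Type*} (P : Equiv.Perm S) (k : S → ℤ) (p : S × ℤ) :
    skewPerm P k p = (P p.1, p.2 + k p.1) := rfl

theorem skewPerm_zpow_fst {S : Type*} (P : Equiv.Perm S) (k : S → ℤ) (n : ℤ) (p : S × ℤ) :
    ((skewPerm P k ^ n) p).1 = (P ^ n) p.1 :=
  (eq_zero_comp_zpow (skewPerm P k) (fun n p => (P ^ n) p.1)
    (fun n p => by simp [zpow_add_one, skewPerm_apply]) n p).symm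

theorem skewPerm_zpow_add {S : Type*} (P : Equiv.Perm S) (k : S → ℤ) (n : ℤ) (i : S)
    (s t : ℤ) :
    (skewPerm P k ^ n) (i, s + t) =
      (((skewPerm P k ^ n) (i, s)).1, ((skewPerm P k ^ n) (i, s)).2 + t) := by
  have h := eq_zero_comp_zpow (skewPerm P k)
    (fun n p => (((skewPerm P k ^ n) (p.1, p.2 - t)).1, ((skewPerm P k ^ n) (p.1, p.2 - t)).2 + t))
    (fun n p => by
      simp only [zpow_add_one, Equiv.Perm.mul_apply, skewPerm_apply]
      rw [sub_add_eq_add_sub]) n (i, s + t)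
  simpa using h.symm

theorem skewPerm_commute {S : Type*} {P Q : Equiv.Perm S} {k l : S → ℤ} (hPQ : Commute P Q)
    (hkl : ∀ i, l (P i) + k i = k (Q i) + l i) : Commute (skewPerm P k) (skewPerm Q l) := by
  ext1 p
  have h1 : P (Q p.1) = Q (P p.1) := congrArg (fun f => f p.1) hPQ.eq
  have h2 := hkl p.1
  simp only [Equiv.Perm.mul_apply, skewPerm_apply, h1, Prod.mk.injEq, true_and]
  lia

/-- If permutations `A`, `C` commute and `A` maps the fibre `U i` to `C ^ k i • U (P i)`, then
the family `C ^ t • U i` intertwines the skew product with `A`. -/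
theorem skewPerm_zpow_smul {S X : Type*} (P : Equiv.Perm S) (k : S → ℤ) (A C : Equiv.Perm X)
    (hAC : Commute A C) (U : S → Set X) (hU : ∀ i, A • U i = C ^ k i • U (P i))
    (n : ℤ) (p : S × ℤ) :
    A ^ n • C ^ p.2 • U p.1 =
      C ^ ((skewPerm P k ^ n) p).2 • U ((skewPerm P k ^ n) p).1 := by
  have h := eq_zero_comp_zpow (skewPerm P k) (fun n p => A ^ n • C ^ p.2 • U p.1)
    (fun n p => by
      simp only [skewPerm_apply]
      rw [zpow_add_one, mul_smul, ← mul_smul A, (hAC.zpow_right p.2).eq, mul_smul, hU, zpow_add,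
        mul_smul]) n p
  simpa using h

theorem coe_subtypePerm_zpow {A : Type*} {p : A → Prop} (J : Equiv.Perm A)
    (hJ : ∀ a, p (J a) ↔ p a) (n : ℤ) (s : {a // p a}) :
    (((J.subtypePerm hJ) ^ n) s : A) = (J ^ n) s := by
  rw [Equiv.Perm.subtypePerm_zpow]; rfl

/-- Under Hypothesis (H), with `k₁, k₂ : {1,…,q} → ℤ` satisfying
the image conditions, the compatibility relation and the extension relations,
and with `J₁, J₂` the commuting permutations of `{1,…,r}` obtained by
restricting `j₁, j₂` (encoded as permutations of `Fin q` preserving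
`{i | (i:ℕ) < r}` and agreeing there with `j₁, j₂`), there is a unique family
`K_{n₁,n₂} : {1,…,q} → ℤ` with `K_{0,0}(i) = β_i` and the recursions
`K_{n₁,n₂+1}(i) = K_{n₁,n₂}(j₂(i)) + k₂(i)`,
`K_{n₁+1,n₂}(i) = K_{n₁,n₂}(j₁(i)) + k₁(i)`; and this family satisfies
(1) `T₁^{n₁} T₂^{n₂} T₃^{−K_{n₁,n₂}(i)}(K_i) = K_{J₂^{n₂}(J₁^{n₁}(j₃(i)))}`
and (2) `K_{m₁,m₂}(J₂^{n₂−m₂}(J₁^{n₁−m₁}(j₃(i)))) + K_{n₁−m₁,n₂−m₂}(i)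
= K_{n₁,n₂}(i)`. -/
theorem stmt_14 {X : Type*} [TopologicalSpace X] [CompactSpace X] [T2Space X]
    [TotallyDisconnectedSpace X] [Nonempty X] (hperf : Perfect (Set.univ : Set X))
    (T₁ T₂ T₃ : X ≃ₜ X)
    (h12 : ∀ x, T₁ (T₂ x) = T₂ (T₁ x)) (h13 : ∀ x, T₁ (T₃ x) = T₃ (T₁ x))
    (h23 : ∀ x, T₂ (T₃ x) = T₃ (T₂ x))
    (Λ : Set X) (hΛ : IsClopen Λ)
    (q r : ℕ) (hr : 1 ≤ r) (hrq : r ≤ q)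
    (K : Fin q → Set X)
    (hKclopen : ∀ i, IsClopen (K i)) (hKne : ∀ i, (K i).Nonempty)
    (hKdisj : ∀ i j : Fin q, i ≠ j → Disjoint (K i) (K j))
    (hKunion : Λ = ⋃ i, K i)
    (j₁ j₂ j₃ : Fin q → Fin q) (β : Fin q → ℤ)
    (hj₃lt : ∀ i, (j₃ i : ℕ) < r)
    (hj₃id : ∀ i : Fin q, (i : ℕ) < r → j₃ i = i ∧ β i = 0)
    (hβ : ∀ i, K i = (T₃.toEquiv ^ β i) '' K (j₃ i))
    (hsat : ∀ i j : Fin q, (i : ℕ) < r → (j : ℕ) < r → i ≠ j →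
      Disjoint (⋃ n : ℤ, (T₃.toEquiv ^ n) '' K i) (⋃ n : ℤ, (T₃.toEquiv ^ n) '' K j))
    (hj₁lt : ∀ i, (j₁ i : ℕ) < r)
    (hj₁ : ∀ i, ∃ m : ℤ, T₁ '' K i = (T₃.toEquiv ^ m) '' K (j₁ i))
    (hj₂lt : ∀ i, (j₂ i : ℕ) < r)
    (hj₂ : ∀ i, ∃ m : ℤ, T₂ '' K i = (T₃.toEquiv ^ m) '' K (j₂ i))
    (k₁ k₂ : Fin q → ℤ)
    (hk₁ : ∀ i : Fin q, T₁ '' ((T₃.toEquiv ^ (-(k₁ i))) '' K i) = K (j₁ i))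
    (hk₂ : ∀ i : Fin q, T₂ '' ((T₃.toEquiv ^ (-(k₂ i))) '' K i) = K (j₂ i))
    (hkcompat : ∀ i : Fin q, k₂ (j₁ i) - k₂ i = k₁ (j₂ i) - k₁ i)
    (hext : ∀ i : Fin q, r ≤ (i : ℕ) → k₁ i = k₁ (j₃ i) + β i ∧ k₂ i = k₂ (j₃ i) + β i)
    (J₁ J₂ : Equiv.Perm (Fin q))
    (hJ1eq : ∀ i : Fin q, (i : ℕ) < r → J₁ i = j₁ i)
    (hJ₁pres : ∀ i : Fin q, ((J₁ i : ℕ) < r ↔ (i : ℕ) < r))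
    (hJ₂eq : ∀ i : Fin q, (i : ℕ) < r → J₂ i = j₂ i)
    (hJ₂pres : ∀ i : Fin q, ((J₂ i : ℕ) < r ↔ (i : ℕ) < r)) :
    (∃! F : ℤ → ℤ → Fin q → ℤ,
      (∀ i : Fin q, F 0 0 i = β i) ∧
      (∀ (n₁ n₂ : ℤ) (i : Fin q), F n₁ (n₂ + 1) i = F n₁ n₂ (j₂ i) + k₂ i) ∧
      (∀ (n₁ n₂ : ℤ) (i : Fin q), F (n₁ + 1) n₂ i = F n₁ n₂ (j₁ i) + k₁ i)) ∧
    (∀ F : ℤ → ℤ → Fin q → ℤ,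
      ((∀ i : Fin q, F 0 0 i = β i) ∧
       (∀ (n₁ n₂ : ℤ) (i : Fin q), F n₁ (n₂ + 1) i = F n₁ n₂ (j₂ i) + k₂ i) ∧
       (∀ (n₁ n₂ : ℤ) (i : Fin q), F (n₁ + 1) n₂ i = F n₁ n₂ (j₁ i) + k₁ i)) →
      (∀ (n₁ n₂ : ℤ) (i : Fin q),
        (T₁.toEquiv ^ n₁) '' ((T₂.toEquiv ^ n₂) ''
            ((T₃.toEquiv ^ (-(F n₁ n₂ i))) '' K i)) =
          K ((J₂ ^ n₂) ((J₁ ^ n₁) (j₃ i)))) ∧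
      (∀ (m₁ m₂ n₁ n₂ : ℤ) (i : Fin q),
        F m₁ m₂ ((J₂ ^ (n₂ - m₂)) ((J₁ ^ (n₁ - m₁)) (j₃ i))) +
            F (n₁ - m₁) (n₂ - m₂) i = F n₁ n₂ i)) := by
  have hAC : Commute T₁.toEquiv T₃.toEquiv := Equiv.ext h13
  have hBC : Commute T₂.toEquiv T₃.toEquiv := Equiv.ext h23
  have hAB : Commute T₁.toEquiv T₂.toEquiv := Equiv.ext h12
  change ∀ i, K i = T₃.toEquiv ^ β i • K (j₃ i) at hβ
  change ∀ i, T₁.toEquiv • T₃.toEquiv ^ (-(k₁ i)) • K i = K (j₁ i) at hk₁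
  change ∀ i, T₂.toEquiv • T₃.toEquiv ^ (-(k₂ i)) • K i = K (j₂ i) at hk₂
  change (_ ∧ ∀ F : ℤ → ℤ → Fin q → ℤ, _ → (∀ (n₁ n₂ : ℤ) (i : Fin q),
    T₁.toEquiv ^ n₁ • T₂.toEquiv ^ n₂ • T₃.toEquiv ^ (-(F n₁ n₂ i)) • K i = _) ∧ _)
  generalize T₁.toEquiv = A at *
  generalize T₂.toEquiv = B at *
  generalize T₃.toEquiv = C at *
  have hA : ∀ i, A • K i = C ^ k₁ i • K (j₁ i) := fun i => by
    rw [← hk₁ i, ← mul_smul, ← mul_smul, ← (hAC.zpow_right _).eq, mul_assoc, ← zpow_add]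
    simp
  have hB : ∀ i, B • K i = C ^ k₂ i • K (j₂ i) := fun i => by
    rw [← hk₂ i, ← mul_smul, ← mul_smul, ← (hBC.zpow_right _).eq, mul_assoc, ← zpow_add]
    simp
  have key : ∀ (a b : Fin q) (s t : ℤ), (a : ℕ) < r → (b : ℕ) < r →
      C ^ s • K a = C ^ t • K b → a = b := by
    intro a b s t ha hb hst
    by_contra hab
    obtain ⟨x, hx⟩ : (C ^ s • K a).Nonempty := (hKne a).image _
    exact Set.disjoint_left.mp (hsat a b ha hb hab) (Set.mem_iUnion.mpr ⟨s, hx⟩)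
      (Set.mem_iUnion.mpr ⟨t, (hst ▸ hx : x ∈ C ^ t • K b)⟩)
  have hA' : ∀ i (s : ℤ), A • C ^ s • K i = C ^ (s + k₁ i) • K (j₁ i) := fun i s => by
    rw [← mul_smul, (hAC.zpow_right _).eq, mul_smul, hA, zpow_add, mul_smul]
  have hB' : ∀ i (s : ℤ), B • C ^ s • K i = C ^ (s + k₂ i) • K (j₂ i) := fun i s => by
    rw [← mul_smul, (hBC.zpow_right _).eq, mul_smul, hB, zpow_add, mul_smul]
  have hj₁₂ : ∀ i, j₁ (j₂ i) = j₂ (j₁ i) := fun i =>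
    key _ _ (k₂ i + k₁ (j₂ i)) (k₁ i + k₂ (j₁ i)) (hj₁lt _) (hj₂lt _) (by
      rw [← hA', ← hB', ← hA, ← hB, ← mul_smul, hAB.eq, mul_smul])
  have hj₁₃ : ∀ i, j₁ (j₃ i) = j₁ i := fun i =>
    key _ _ (β i + k₁ (j₃ i)) (k₁ i) (hj₁lt _) (hj₁lt _) (by rw [← hA', ← hA, ← hβ])
  have hj₂₃ : ∀ i, j₂ (j₃ i) = j₂ i := fun i =>
    key _ _ (β i + k₂ (j₃ i)) (k₂ i) (hj₂lt _) (hj₂lt _) (by rw [← hB', ← hB, ← hβ])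
  have hext' : ∀ i, k₁ i = k₁ (j₃ i) + β i ∧ k₂ i = k₂ (j₃ i) + β i := fun i => by
    rcases lt_or_ge (i : ℕ) r with h | h
    · simp [hj₃id i h]
    · exact hext i h
  let S := {i : Fin q // (i : ℕ) < r}
  let P₁ : Equiv.Perm S := J₁.subtypePerm hJ₁pres
  let P₂ : Equiv.Perm S := J₂.subtypePerm hJ₂pres
  have hP₁ : ∀ i : S, (P₁ i : Fin q) = j₁ i := fun i => hJ1eq i i.2
  have hP₂ : ∀ i : S, (P₂ i : Fin q) = j₂ i := fun i => hJ₂eq i i.2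
  have hP : Commute P₁ P₂ := by
    ext1 i
    apply Subtype.ext
    simp only [Equiv.Perm.mul_apply, hP₁, hP₂, hj₁₂]
  let e₁ : Equiv.Perm (S × ℤ) := skewPerm P₁ (fun i => k₁ i)
  let e₂ : Equiv.Perm (S × ℤ) := skewPerm P₂ (fun i => k₂ i)
  have he : Commute e₁ e₂ := skewPerm_commute hP fun i => by
    have := hkcompat i
    simp only [hP₁, hP₂]
    lia
  let b : Fin q → S × ℤ := fun i => (⟨j₃ i, hj₃lt i⟩, β i)
  let G : ℤ → ℤ → Fin q → ℤ := fun n₁ n₂ i => ((e₂ ^ n₂) ((e₁ ^ n₁) (b i))).2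
  have hb₁ : ∀ i, e₁ (b i) = ((b (j₁ i)).1, (b (j₁ i)).2 + k₁ i) := fun i => by
    refine Prod.ext (Subtype.ext ?_) ?_
    · exact (hP₁ _).trans ((hj₁₃ i).trans (hj₃id _ (hj₁lt i)).1.symm)
    · have h1 := (hext' i).1
      have h2 := (hj₃id _ (hj₁lt i)).2
      simp only [e₁, b, skewPerm_apply]
      lia
  have hb₂ : ∀ i, e₂ (b i) = ((b (j₂ i)).1, (b (j₂ i)).2 + k₂ i) := fun i => by
    refine Prod.ext (Subtype.ext ?_) ?_
    · exact (hP₂ _).trans ((hj₂₃ i).trans (hj₃id _ (hj₂lt i)).1.symm)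
    · have h1 := (hext' i).2
      have h2 := (hj₃id _ (hj₂lt i)).2
      simp only [e₂, b, skewPerm_apply]
      lia
  have hadd : ∀ (n₁ n₂ : ℤ) (i : S) (s t : ℤ), ((e₂ ^ n₂) ((e₁ ^ n₁) (i, s + t))).2 =
      ((e₂ ^ n₂) ((e₁ ^ n₁) (i, s))).2 + t := fun n₁ n₂ i s t => by
    simp only [e₁, e₂, skewPerm_zpow_add]
  have hG : (∀ i : Fin q, G 0 0 i = β i) ∧
      (∀ (n₁ n₂ : ℤ) (i : Fin q), G n₁ (n₂ + 1) i = G n₁ n₂ (j₂ i) + k₂ i) ∧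
      (∀ (n₁ n₂ : ℤ) (i : Fin q), G (n₁ + 1) n₂ i = G n₁ n₂ (j₁ i) + k₁ i) := by
    refine ⟨fun i => by simp [G, b], fun n₁ n₂ i => ?_, fun n₁ n₂ i => ?_⟩
    · simp only [G]
      rw [zpow_add_one, Equiv.Perm.mul_apply, ← Equiv.Perm.mul_apply e₂ (e₁ ^ n₁),
        ← (he.zpow_left n₁).eq, Equiv.Perm.mul_apply, hb₂, hadd]
    · simp only [G]
      rw [zpow_add_one, Equiv.Perm.mul_apply, hb₁, hadd]
  have huniq : ∀ F : ℤ → ℤ → Fin q → ℤ, ((∀ i : Fin q, F 0 0 i = β i) ∧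
      (∀ (n₁ n₂ : ℤ) (i : Fin q), F n₁ (n₂ + 1) i = F n₁ n₂ (j₂ i) + k₂ i) ∧
      (∀ (n₁ n₂ : ℤ) (i : Fin q), F (n₁ + 1) n₂ i = F n₁ n₂ (j₁ i) + k₁ i)) → F = G := by
    rintro F ⟨h0, h2, h1⟩
    funext n₁ n₂ i
    have hF : F n₁ n₂ i = F n₁ n₂ (j₃ i) + β i := by
      have h := h1 (n₁ - 1) n₂
      rw [sub_add_cancel] at h
      rw [h, h, hj₁₃, (hext' i).1, add_assoc]
    have e1 := eq_zero_comp_zpow e₁ (fun n p => F n n₂ p.1 + p.2)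
      (fun n p => by simp only [e₁, skewPerm_apply, hP₁, h1]; lia) n₁ (b i)
    have e2 := eq_zero_comp_zpow e₂ (fun n p => F 0 n p.1 + p.2)
      (fun n p => by simp only [e₂, skewPerm_apply, hP₂, h2]; lia) n₂ ((e₁ ^ n₁) (b i))
    simp only [h0, hj₃id _ (((e₂ ^ n₂) ((e₁ ^ n₁) (b i))).1).2, zero_add] at e2
    exact hF.trans (e1.trans e2)
  refine ⟨⟨G, hG, huniq⟩, fun F hF => ?_⟩
  obtain rfl := huniq F hF
  have hfst : ∀ (n₁ n₂ : ℤ) (p : S × ℤ), (((e₂ ^ n₂) ((e₁ ^ n₁) p)).1 : Fin q) =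
      (J₂ ^ n₂) ((J₁ ^ n₁) p.1) := fun n₁ n₂ p => by
    simp only [e₁, e₂, skewPerm_zpow_fst]
    exact (coe_subtypePerm_zpow J₂ hJ₂pres n₂ _).trans
      (congrArg _ (coe_subtypePerm_zpow J₁ hJ₁pres n₁ p.1))
  refine ⟨fun n₁ n₂ i => ?_, fun m₁ m₂ n₁ n₂ i => ?_⟩
  · have s1 := skewPerm_zpow_smul P₁ (fun i => k₁ i) A C hAC (fun i : S => K i)
      (fun i => by rw [hP₁, hA]) n₁ (b i)
    have s2 := skewPerm_zpow_smul P₂ (fun i => k₂ i) B C hBC (fun i : S => K i)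
      (fun i => by rw [hP₂, hB]) n₂ ((e₁ ^ n₁) (b i))
    have hΦ : C ^ (b i).2 • K (b i).1 = K i := (hβ i).symm
    have s3 : B ^ n₂ • A ^ n₁ • K i = C ^ G n₁ n₂ i • K ((J₂ ^ n₂) ((J₁ ^ n₁) (j₃ i))) := by
      rw [← hΦ, s1]
      refine s2.trans ?_
      rw [← hfst n₁ n₂ (b i)]
    have hc₁ := hAC.zpow_zpow n₁ (-(G n₁ n₂ i))
    have hc₂ := hBC.zpow_zpow n₂ (-(G n₁ n₂ i))
    calc A ^ n₁ • B ^ n₂ • C ^ (-(G n₁ n₂ i)) • K i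
        = C ^ (-(G n₁ n₂ i)) • B ^ n₂ • A ^ n₁ • K i := by
          simp only [← mul_smul]
          rw [hc₂.eq, ← mul_assoc, hc₁.eq, mul_assoc, (hAB.zpow_zpow n₁ n₂).eq]
      _ = _ := by rw [s3, ← mul_smul, ← zpow_add]; simp
  · set i' : Fin q := (J₂ ^ (n₂ - m₂)) ((J₁ ^ (n₁ - m₁)) (j₃ i)) with hi'
    set p := (e₂ ^ (n₂ - m₂)) ((e₁ ^ (n₁ - m₁)) (b i)) with hp
    have hpi : (p.1 : Fin q) = i' := hfst _ _ _
    have hlt : (i' : ℕ) < r := hpi ▸ p.1.2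
    have hbp : p = ((b i').1, (b i').2 + G (n₁ - m₁) (n₂ - m₂) i) := by
      refine Prod.ext (Subtype.ext ?_) ?_
      · exact hpi.trans (hj₃id _ hlt).1.symm
      · simp [b, (hj₃id _ hlt).2, G, hp]
    have h1 : (e₂ ^ n₂) ((e₁ ^ n₁) (b i)) = (e₂ ^ m₂) ((e₁ ^ m₁) p) := by
      simp only [hp, ← Equiv.Perm.mul_apply]
      congr 1
      rw [← mul_assoc (e₁ ^ m₁), (he.zpow_zpow m₁ (n₂ - m₂)).eq, mul_assoc,
        ← zpow_add, ← mul_assoc, ← zpow_add, add_sub_cancel, add_sub_cancel]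
    change _ = ((e₂ ^ n₂) ((e₁ ^ n₁) (b i))).2
    rw [h1, hbp, hadd]
end
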